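/- arXiv:1006.2637 — 4 statements merged into one kernel-verified Lean document; each statement's English description precedes it below -/
import Mathlib

section
/- Let K be a positive natural number and let ℓ ≤ K. Let σ^p : Fin K → {0,1} be the packed pattern, defined by σ^p(j) = 1 if j < ℓ and σ^p(j) = 0 otherwise. Then for every window length w with 0 ≤ w ≤ K, the maximum cyclic window sum equals min(ℓ, w): max_{0 ≤ c ≤ K−1} ∑_{j=c}^{c+w−1} σ^p(j mod K) = min(ℓ, w), and this maximum is attained at c = 0. -/
/-- A cyclic window of length `w ≤ K` contains at most `min ℓ w` positions with residue below `ℓ`. -/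
theorem card_filter_add_mod_lt_le_min (K ℓ c w : ℕ) (hw : w ≤ K) :
    ((Finset.range w).filter fun j => (c + j) % K < ℓ).card ≤ min ℓ w := by
  refine le_min ?_ ((Finset.card_filter_le _ _).trans_eq (Finset.card_range w))
  rw [← Finset.card_range ℓ]
  refine Finset.card_le_card_of_injOn (fun j => (c + j) % K) (fun j hj => ?_)
    fun a ha b hb hab => ?_
  · simpa using (Finset.mem_filter.mp hj).2
  · have ha' := Finset.mem_range.mp (Finset.mem_filter.mp ha).1
    have hb' := Finset.mem_range.mp (Finset.mem_filter.mp hb).1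
    exact Nat.ModEq.eq_of_lt_of_lt (Nat.ModEq.add_left_cancel' c hab)
      (ha'.trans_le hw) (hb'.trans_le hw)

/-- The window of length `w ≤ K` starting at `0` contains exactly `min ℓ w` positions below `ℓ`. -/
theorem card_filter_zero_add_mod_lt (K ℓ w : ℕ) (hw : w ≤ K) :
    ((Finset.range w).filter fun j => (0 + j) % K < ℓ).card = min ℓ w := by
  rw [← Finset.card_range (min ℓ w)]
  congr 1
  ext j
  simp only [Finset.mem_filter, Finset.mem_range, zero_add, lt_min_iff]
  constructor
  · rintro ⟨hj, h⟩
    exact ⟨by rwa [Nat.mod_eq_of_lt (hj.trans_le hw)] at h, hj⟩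
  · rintro ⟨h, hj⟩
    exact ⟨hj, by rwa [Nat.mod_eq_of_lt (hj.trans_le hw)]⟩

/-- For the packed pattern `σᵖ : Fin K → {0,1}` with `ℓ ≤ K`
nonzero entries (`σᵖ j = 1` iff `j < ℓ`), for every window length `w ≤ K` the
maximum cyclic window sum over starting indices `0 ≤ c ≤ K-1` equals `min ℓ w`,
and this maximum is attained at `c = 0`. -/
theorem packed_max_cyclic_window_sum
    (K : ℕ) (hK : 0 < K) (ℓ : ℕ) (hℓ : ℓ ≤ K)
    (σp : Fin K → ℕ) (hσp : ∀ j : Fin K, σp j = if (j : ℕ) < ℓ then 1 else 0)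
    (w : ℕ) (hw : w ≤ K) :
    ((Finset.range K).sup fun c =>
        ∑ j ∈ Finset.range w, σp ⟨(c + j) % K, Nat.mod_lt _ hK⟩) = min ℓ w ∧
    (∑ j ∈ Finset.range w, σp ⟨(0 + j) % K, Nat.mod_lt _ hK⟩) = min ℓ w := by
  simp only [hσp, ← Finset.card_filter]
  have h₀ := card_filter_zero_add_mod_lt K ℓ w hw
  refine ⟨le_antisymm (Finset.sup_le fun c _ => card_filter_add_mod_lt_le_min K ℓ c w hw) ?_, h₀⟩
  exact h₀.ge.trans <| Finset.le_sup
    (f := fun c => ((Finset.range w).filter fun j => (c + j) % K < ℓ).card)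
    (Finset.mem_range.mpr hK)
end

section
/- Let K be a positive natural number, σ : Fin K → {0,1} a multiframe execution pattern with ℓ(σ) nonzero entries, C ≥ 0 a real execution requirement, and D, T real numbers with 0 < D ≤ T. For every real t ≥ 0, the demand bound function with pattern evaluated at the packed pattern σ^p of σ equals the packed-scenario demand bound function: s(t)·ℓ(σ)·C + max_{0 ≤ c ≤ K−1} ∑_{j=c}^{c+max(0,nb(t))−1} σ^p(j mod K)·C = s(t)·ℓ(σ)·C + min(ℓ(σ), max(0, nb(t)))·C. -/
/-- `ℓ(σ)`: number of nonzero entries of a multiframe execution pattern. -/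
def numNonzero {K : ℕ} (σ : Fin K → ℕ) : ℕ :=
  (Finset.univ.filter fun j => σ j = 1).card

/-- The packed pattern `σᵖ` of a pattern `σ`: ones at indices `j < ℓ(σ)`, zeros after. -/
def packedOf {K : ℕ} (σ : Fin K → ℕ) : Fin K → ℕ :=
  fun j => if (j : ℕ) < numNonzero σ then 1 else 0

/-- The demand bound function with pattern:
`D̂̂(σ,t) = s(t)·ℓ(σ)·C + max_{0 ≤ c ≤ K−1} ∑_{j=c}^{c+max(0,nb(t))−1} σ(j mod K)·C`,
where `s(t) = ⌊t/(K·T)⌋` and `nb(t) = ⌊((t − s(t)·K·T) − D)/T⌋ + 1`. -/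
noncomputable def dbfPattern (K : ℕ) (hK : 0 < K) (σ : Fin K → ℕ)
    (C D T t : ℝ) : ℝ :=
  let s : ℤ := ⌊t / (K * T)⌋
  let nb : ℤ := ⌊((t - s * (K * T)) - D) / T⌋ + 1
  (s : ℝ) * (numNonzero σ) * C +
    (Finset.range K).sup' (Finset.nonempty_range_iff.mpr hK.ne')
      (fun c => ∑ j ∈ Finset.range (max 0 nb).toNat,
        (σ ⟨(c + j) % K, Nat.mod_lt _ hK⟩ : ℝ) * C)

theorem numNonzero_le {K : ℕ} (σ : Fin K → ℕ) : numNonzero σ ≤ K := by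
  simpa [numNonzero] using Finset.card_filter_le Finset.univ fun j => σ j = 1

/-- A window of at most `K` consecutive indices meets at most `ℓ(σ)` ones of `σᵖ`. -/
theorem sum_packedOf_window_le {K : ℕ} (hK : 0 < K) (σ : Fin K → ℕ) (c : ℕ) {n : ℕ}
    (hn : n ≤ K) :
    ∑ j ∈ Finset.range n, packedOf σ ⟨(c + j) % K, Nat.mod_lt _ hK⟩
      ≤ min (numNonzero σ) n := by
  simp only [packedOf, ← Finset.card_filter]
  refine le_min ?_ ((Finset.card_filter_le _ _).trans (Finset.card_range n).le)
  have hinj : Set.InjOn (fun j => (c + j) % K)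
      ((Finset.range n).filter fun j => (c + j) % K < numNonzero σ) := by
    intro i hi j hj hij
    simp only [Finset.coe_filter, Finset.mem_range, Set.mem_ofPred_eq] at hi hj
    exact (Nat.ModEq.add_left_cancel' c hij).eq_of_lt_of_lt (hi.1.trans_le hn)
      (hj.1.trans_le hn)
  have hcard := Finset.card_le_card_of_injOn (t := Finset.range (numNonzero σ)) _
    (fun j hj => by simpa using (Finset.mem_filter.mp hj).2) hinj
  rwa [Finset.card_range] at hcard

/-- The window starting at index `0` collects `min(ℓ(σ), n)` ones of `σᵖ`. -/
theorem sum_packedOf_initial_window {K : ℕ} (hK : 0 < K) (σ : Fin K → ℕ) {n : ℕ}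
    (hn : n ≤ K) :
    ∑ j ∈ Finset.range n, packedOf σ ⟨(0 + j) % K, Nat.mod_lt _ hK⟩
      = min (numNonzero σ) n := by
  simp only [packedOf, ← Finset.card_filter]
  rw [← Finset.card_range (min (numNonzero σ) n)]
  congr 1
  ext j
  simp only [Finset.mem_filter, Finset.mem_range, lt_min_iff, zero_add]
  constructor
  · rintro ⟨hjn, hj⟩
    rw [Nat.mod_eq_of_lt (hjn.trans_le hn)] at hj
    exact ⟨hj, hjn⟩
  · rintro ⟨hj, hjn⟩
    rw [Nat.mod_eq_of_lt (hjn.trans_le hn)]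
    exact ⟨hjn, hj⟩

/-- At most `K` deadlines fall in the part of `[0, t]` left after the full hyperperiods. -/
theorem deadline_count_le {K : ℕ} (hK : 0 < K) {D T : ℝ} (hD : 0 < D) (hT : 0 < T) (t : ℝ) :
    ⌊((t - (⌊t / (K * T)⌋ : ℤ) * (K * T)) - D) / T⌋ + 1 ≤ (K : ℤ) := by
  have hKT : 0 < (K : ℝ) * T := mul_pos (Nat.cast_pos.mpr hK) hT
  have hlt : t < ((⌊t / (K * T)⌋ : ℤ) + 1 : ℝ) * (K * T) :=
    (div_lt_iff₀ hKT).mp (Int.lt_floor_add_one _)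
  rw [Int.add_one_le_iff, Int.floor_lt, Int.cast_natCast, div_lt_iff₀ hT]
  linarith

/-- The demand bound function with pattern, evaluated at the
packed pattern `σᵖ` of `σ`, equals the packed-scenario demand bound function:
`s(t)·ℓ(σ)·C + max_c ∑ σᵖ((c+j) mod K)·C = s(t)·ℓ(σ)·C + min(ℓ(σ), max(0,nb(t)))·C`. -/
theorem dbfPattern_packed_eq_packedScenario
    (K : ℕ) (hK : 0 < K) (σ : Fin K → ℕ) (hσ : ∀ j, σ j = 0 ∨ σ j = 1)
    (C D T : ℝ) (hC : 0 ≤ C) (hD : 0 < D) (hDT : D ≤ T)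
    (t : ℝ) (ht : 0 ≤ t) :
    (let s : ℤ := ⌊t / (K * T)⌋
     let nb : ℤ := ⌊((t - s * (K * T)) - D) / T⌋ + 1
     (s : ℝ) * (numNonzero σ) * C +
       (Finset.range K).sup' (Finset.nonempty_range_iff.mpr hK.ne')
         (fun c => ∑ j ∈ Finset.range (max 0 nb).toNat,
           (packedOf σ ⟨(c + j) % K, Nat.mod_lt _ hK⟩ : ℝ) * C)) =
    (let s : ℤ := ⌊t / (K * T)⌋
     let nb : ℤ := ⌊((t - s * (K * T)) - D) / T⌋ + 1
     (s : ℝ) * (numNonzero σ) * C +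
       ((min ((numNonzero σ : ℤ)) (max 0 nb) : ℤ) : ℝ) * C) := by
  have hnb := deadline_count_le hK hD (hD.trans_le hDT) t
  dsimp only
  generalize ⌊((t - (⌊t / (K * T)⌋ : ℤ) * (K * T)) - D) / T⌋ + 1 = nb at hnb ⊢
  obtain ⟨n, hn⟩ := Int.eq_ofNat_of_zero_le (le_max_left 0 nb)
  have hnK : n ≤ K := by omega
  rw [hn, Int.toNat_natCast, ← Nat.cast_min, Int.cast_natCast]
  simp only [← Finset.sum_mul, ← Nat.cast_sum]
  congr 1
  apply le_antisymm
  · refine Finset.sup'_le _ _ fun c _ => mul_le_mul_of_nonneg_right ?_ hC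
    exact Nat.cast_le.mpr (sum_packedOf_window_le hK σ c hnK)
  · rw [← sum_packedOf_initial_window hK σ hnK]
    exact Finset.le_sup' (fun c => ((∑ j ∈ Finset.range n,
      packedOf σ ⟨(c + j) % K, Nat.mod_lt _ hK⟩ : ℕ) : ℝ) * C) (Finset.mem_range.mpr hK)
end

section
/- (Lemma, packed pattern dominates.) Let K be a positive natural number, σ : Fin K → {0,1} a multiframe execution pattern with ℓ(σ) nonzero entries, C ≥ 0 a real execution requirement, and D, T real numbers with 0 < D ≤ T. Let σ^p be the packed pattern of σ. Then for every real t ≥ 0, D̂̂(σ, t) ≤ D̂̂(σ^p, t). -/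
theorem numNonzero_packedOf {K : ℕ} (σ : Fin K → ℕ) :
    numNonzero (packedOf σ) = numNonzero σ := by
  have h := Fin.card_filter_val_lt (n := K) (m := numNonzero σ)
  rw [min_eq_right (numNonzero_le σ)] at h
  rw [← h, numNonzero]
  congr 1
  ext j
  simp [packedOf]

theorem sum_eq_numNonzero {K : ℕ} {σ : Fin K → ℕ} (hσ : ∀ j, σ j = 0 ∨ σ j = 1) :
    ∑ j, σ j = numNonzero σ := by
  rw [numNonzero, Finset.card_filter]
  refine Finset.sum_congr rfl fun j _ => ?_
  rcases hσ j with h | h <;> simp [h]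

/-- A cyclic window of length `n ≤ K` meets at most `min n ℓ(σ)` nonzero entries. -/
theorem sum_window_le_min {K : ℕ} (hK : 0 < K) {σ : Fin K → ℕ}
    (hσ : ∀ j, σ j = 0 ∨ σ j = 1) {n : ℕ} (hn : n ≤ K) (c : ℕ) :
    ∑ j ∈ Finset.range n, σ ⟨(c + j) % K, Nat.mod_lt _ hK⟩ ≤ min n (numNonzero σ) := by
  refine le_min ?_ ?_
  · calc ∑ j ∈ Finset.range n, σ ⟨(c + j) % K, Nat.mod_lt _ hK⟩
        ≤ ∑ _j ∈ Finset.range n, 1 :=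
          Finset.sum_le_sum fun j _ => by
            rcases hσ ⟨(c + j) % K, Nat.mod_lt _ hK⟩ with h | h <;> simp [h]
      _ = n := by simp
  · have hinj : Set.InjOn (fun j : ℕ => (⟨(c + j) % K, Nat.mod_lt _ hK⟩ : Fin K))
        (Finset.range n) := by
      intro a ha b hb hab
      have hmod : a ≡ b [MOD K] := Nat.ModEq.add_left_cancel' c (Fin.mk.inj_iff.mp hab)
      exact hmod.eq_of_lt_of_lt ((Finset.mem_range.mp ha).trans_le hn)
        ((Finset.mem_range.mp hb).trans_le hn)
    rw [← sum_eq_numNonzero hσ, ← Finset.sum_image (f := σ) hinj]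
    exact Finset.sum_le_sum_of_subset (Finset.subset_univ _)

/-- The window of the packed pattern starting at `0` attains `min n ℓ(σ)`. -/
theorem sum_window_packedOf {K : ℕ} (hK : 0 < K) (σ : Fin K → ℕ) {n : ℕ} (hn : n ≤ K) :
    ∑ j ∈ Finset.range n, packedOf σ ⟨(0 + j) % K, Nat.mod_lt _ hK⟩ =
      min n (numNonzero σ) := by
  calc ∑ j ∈ Finset.range n, packedOf σ ⟨(0 + j) % K, Nat.mod_lt _ hK⟩
      = ∑ j ∈ Finset.range n, if j < numNonzero σ then 1 else 0 :=
        Finset.sum_congr rfl fun j hj => by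
          simp [packedOf, Nat.mod_eq_of_lt ((Finset.mem_range.mp hj).trans_le hn)]
    _ = (Finset.range (min n (numNonzero σ))).card := by
        rw [← Finset.card_filter]
        congr 1
        ext j
        simp
    _ = min n (numNonzero σ) := Finset.card_range _

/-- At most `K` jobs have their deadline within the remainder of `t` modulo `K * T`. -/
theorem floor_remainder_add_one_le {K : ℕ} (hK : 0 < K) {D T : ℝ} (hD : 0 < D) (hT : 0 < T)
    (t : ℝ) : ⌊((t - ⌊t / (K * T)⌋ * (K * T)) - D) / T⌋ + 1 ≤ (K : ℤ) := by
  have hKT : 0 < (K : ℝ) * T := mul_pos (Nat.cast_pos.mpr hK) hT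
  have hlt := (div_lt_iff₀ hKT).mp (Int.lt_floor_add_one (t / (K * T)))
  rw [Int.add_one_le_iff, Int.floor_lt, div_lt_iff₀ hT]
  push_cast
  linarith

/-- **Lemma: packed pattern dominates.** For any multiframe
execution pattern `σ : Fin K → {0,1}`, `C ≥ 0` and `0 < D ≤ T`, we have
`D̂̂(σ, t) ≤ D̂̂(σᵖ, t)` for every `t ≥ 0`. -/
theorem dbfPattern_le_dbfPattern_packed
    (K : ℕ) (hK : 0 < K) (σ : Fin K → ℕ) (hσ : ∀ j, σ j = 0 ∨ σ j = 1)
    (C D T : ℝ) (hC : 0 ≤ C) (hD : 0 < D) (hDT : D ≤ T)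
    (t : ℝ) (ht : 0 ≤ t) :
    dbfPattern K hK σ C D T t ≤ dbfPattern K hK (packedOf σ) C D T t := by
  unfold dbfPattern
  simp only [numNonzero_packedOf]
  have hnb := floor_remainder_add_one_le hK hD (hD.trans_le hDT) t
  generalize ⌊((t - ⌊t / (K * T)⌋ * (K * T)) - D) / T⌋ + 1 = nb at hnb ⊢
  have hn : (max 0 nb).toNat ≤ K := by omega
  refine add_le_add le_rfl (Finset.sup'_le _ _ fun c _ => ?_)
  refine le_trans ?_ (Finset.le_sup' _ (Finset.mem_range.mpr hK))
  rw [← Finset.sum_mul, ← Finset.sum_mul]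
  refine mul_le_mul_of_nonneg_right ?_ hC
  exact_mod_cast (sum_window_le_min hK hσ hn c).trans_eq (sum_window_packedOf hK σ hn).symm
end

section
/- (Regularity of the most regular job-assignment sequence.) Let K be a positive natural number and A a natural number with A ≤ K. For all natural numbers c and w, the number of jobs assigned to the processor among the w consecutive jobs with indices c, c+1, …, c+w−1 satisfies ⌊w·A/K⌋ ≤ ∑_{ℓ=c}^{c+w−1} (⌈(ℓ+1)·A/K⌉ − ⌈ℓ·A/K⌉) ≤ ⌈w·A/K⌉; in particular, the counts over any two windows of the same length differ by at most 1. -/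
/-- A window of increments of `ℓ ↦ ⌈ℓ·a/k⌉` telescopes. -/
theorem sum_Ico_ceil_increments (a k : ℚ) (c w : ℕ) :
    ∑ ℓ ∈ Finset.Ico c (c + w), (⌈(((ℓ : ℚ) + 1) * a) / k⌉ - ⌈((ℓ : ℚ) * a) / k⌉) =
      ⌈((c : ℚ) * a) / k + ((w : ℚ) * a) / k⌉ - ⌈((c : ℚ) * a) / k⌉ := by
  have h := Finset.sum_Ico_sub (fun ℓ : ℕ => ⌈((ℓ : ℚ) * a) / k⌉) (Nat.le_add_right c w)
  simp only [Nat.cast_add, Nat.cast_one] at h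
  rw [h, add_mul, add_div]

theorem floor_add_ceil_le_ceil_add (x y : ℚ) : ⌊y⌋ + ⌈x⌉ ≤ ⌈x + y⌉ := by
  rw [add_comm, ← Int.ceil_add_intCast]
  exact Int.ceil_mono (by gcongr; exact Int.floor_le y)

/-- **Regularity of the most regular job-assignment sequence.**
For all `c w : ℕ`, the number of jobs assigned to the processor among the `w`
consecutive jobs with indices `c, c+1, …, c+w−1` satisfies
`⌊w·A/K⌋ ≤ ∑_{ℓ=c}^{c+w−1} (⌈(ℓ+1)·A/K⌉ − ⌈ℓ·A/K⌉) ≤ ⌈w·A/K⌉`. -/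
theorem regular_sequence_window_bounds
    (K : ℕ) (hK : 0 < K) (A : ℕ) (hA : A ≤ K) (c w : ℕ) :
    ⌊((w : ℚ) * A) / K⌋ ≤
      ∑ ℓ ∈ Finset.Ico c (c + w),
        (⌈(((ℓ : ℚ) + 1) * A) / K⌉ - ⌈((ℓ : ℚ) * A) / K⌉) ∧
    ∑ ℓ ∈ Finset.Ico c (c + w),
        (⌈(((ℓ : ℚ) + 1) * A) / K⌉ - ⌈((ℓ : ℚ) * A) / K⌉) ≤
      ⌈((w : ℚ) * A) / K⌉ := by
  rw [sum_Ico_ceil_increments]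
  have lower := floor_add_ceil_le_ceil_add ((c * A : ℚ) / K) ((w * A : ℚ) / K)
  have upper := Int.ceil_add_le ((c * A : ℚ) / K) ((w * A : ℚ) / K)
  constructor <;> linarith
end
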